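/- Let S be a solution concept that permits bracketing, satisfies expectation-monotonicity, and is such that in every solution of every game no player plays a strictly dominated action with positive probability (i.e., for every game G=(A,u), every p∈S(G), every player i and every strictly dominated action a_i∈A_i, p_i(a_i)=0). Then S is a refinement of Nash. -/

import Mathlib

open Filter Topology MeasureTheory

noncomputable section

namespace Paper

/-! ## Lotteries as finitely supported probability mass functions on ℝ -/

open Classical in
/-- The point mass at `a`. -/
def delta {α : Type*} (a : α) : α → ℝ := fun b => if b = a then 1 else 0

/-- `f` is (the p.m.f. of) a finitely supported lottery. -/
def IsFinLottery (f : ℝ → ℝ) : Prop :=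
  (∀ x, 0 ≤ f x) ∧ (Function.support f).Finite ∧ ∑ᶠ x, f x = 1

/-- The CDF of a mass function. -/
def cdfOf (f : ℝ → ℝ) (t : ℝ) : ℝ := ∑ᶠ x, if x ≤ t then f x else 0

/-- Convolution: the distribution of the sum of independent draws. -/
def conv (f g : ℝ → ℝ) : ℝ → ℝ := fun z => ∑ᶠ x, f x * g (z - x)

/-- Expectation of a finitely supported lottery. -/
def expOf (f : ℝ → ℝ) : ℝ := ∑ᶠ x, x * f x

/-- Weak first-order stochastic dominance of `f` over `g`. -/
def FOSDgeF (f g : ℝ → ℝ) : Prop := ∀ t, cdfOf f t ≤ cdfOf g t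

/-- Strict first-order stochastic dominance of `f` over `g`. -/
def FOSDgtF (f g : ℝ → ℝ) : Prop := FOSDgeF f g ∧ f ≠ g

/-- Finitely supported lotteries with rational-valued CDF (`Δ_ℚ`). -/
def IsDeltaQ (f : ℝ → ℝ) : Prop := IsFinLottery f ∧ ∀ t, ∃ q : ℚ, cdfOf f t = (q : ℝ)

/-- Monotone additive statistic on all finitely supported lotteries. -/
def MAS (Φ : (ℝ → ℝ) → ℝ) : Prop :=
  (∀ c : ℝ, Φ (delta c) = c) ∧
  (∀ f g, IsFinLottery f → IsFinLottery g → Φ (conv f g) = Φ f + Φ g) ∧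
  (∀ f g, IsFinLottery f → IsFinLottery g → FOSDgeF f g → Φ g ≤ Φ f)

/-- Monotone additive statistic on `Δ_ℚ`. -/
def MASQ (Φ : (ℝ → ℝ) → ℝ) : Prop :=
  (∀ c : ℝ, Φ (delta c) = c) ∧
  (∀ f g, IsDeltaQ f → IsDeltaQ g → Φ (conv f g) = Φ f + Φ g) ∧
  (∀ f g, IsDeltaQ f → IsDeltaQ g → FOSDgeF f g → Φ g ≤ Φ f)

/-- The statistic `K_a` for `a` in the extended real line. -/
def Kstat (a : EReal) (f : ℝ → ℝ) : ℝ :=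
  if a = ⊤ then sSup (Function.support f)
  else if a = ⊥ then sInf (Function.support f)
  else if a = 0 then expOf f
  else (a.toReal)⁻¹ * Real.log (∑ᶠ x, Real.exp (a.toReal * x) * f x)

/-- `K_a` for real `a`. -/
def Kreal (a : ℝ) : (ℝ → ℝ) → ℝ := Kstat (a : EReal)

/-- The statistic `Φ[X] = ∫ K_a[X] dμ(a)`. -/
def PhiInt (μ : Measure EReal) (f : ℝ → ℝ) : ℝ := ∫ a, Kstat a f ∂μ

/-! ## Finite normal-form games -/

structure Game (N : ℕ) where
  A : Fin N → Type
  fintypeA : ∀ i, Fintype (A i)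
  nonemptyA : ∀ i, Nonempty (A i)
  u : ((i : Fin N) → A i) → Fin N → ℝ

instance {N : ℕ} (G : Game N) (i : Fin N) : Fintype (G.A i) := G.fintypeA i
instance {N : ℕ} (G : Game N) (i : Fin N) : Nonempty (G.A i) := G.nonemptyA i

/-- A (mixed strategy) profile: a real-valued function on each action set. -/
abbrev Profile {N : ℕ} (G : Game N) := (i : Fin N) → G.A i → ℝ

/-- `p` is a mixed strategy profile. -/
def IsMixed {N : ℕ} (G : Game N) (p : Profile G) : Prop :=
  ∀ i, (∀ ai, 0 ≤ p i ai) ∧ ∑ ai, p i ai = 1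

/-- Probability of the full action profile `a` under independent mixing `p`. -/
def weight {N : ℕ} (G : Game N) (p : Profile G) (a : (i : Fin N) → G.A i) : ℝ :=
  ∏ j, p j (a j)

/-- The p.m.f. of player `i`'s payoff lottery `u_i(a_i, p_{-i})`. -/
def payMass {N : ℕ} (G : Game N) (p : Profile G) (i : Fin N) (ai : G.A i) : ℝ → ℝ :=
  fun t => ∑ a : (j : Fin N) → G.A j,
    if G.u a i = t then weight G (Function.update p i (delta ai)) a else 0

/-- Expected payoff `E[u_i(a_i, p_{-i})]`. -/
def expPay {N : ℕ} (G : Game N) (p : Profile G) (i : Fin N) (ai : G.A i) : ℝ :=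
  ∑ a : (j : Fin N) → G.A j, weight G (Function.update p i (delta ai)) a * G.u a i

/-- Expected value of `f` applied to player `i`'s payoff lottery. -/
def expPayOf {N : ℕ} (G : Game N) (p : Profile G) (i : Fin N) (ai : G.A i) (f : ℝ → ℝ) : ℝ :=
  ∑ a : (j : Fin N) → G.A j, weight G (Function.update p i (delta ai)) a * f (G.u a i)

/-- Minimum over `a_{-i}` of `u_i(a_i, a_{-i})`. -/
def minPay {N : ℕ} (G : Game N) (i : Fin N) (ai : G.A i) : ℝ :=
  ⨅ a : (j : Fin N) → G.A j, G.u (Function.update a i ai) i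

/-- Maximum over `a_{-i}` of `u_i(a_i, a_{-i})`. -/
def maxPay {N : ℕ} (G : Game N) (i : Fin N) (ai : G.A i) : ℝ :=
  ⨆ a : (j : Fin N) → G.A j, G.u (Function.update a i ai) i

/-- `a_i` is strictly dominated (by some `b_i`). -/
def StrictlyDominated {N : ℕ} (G : Game N) (i : Fin N) (ai : G.A i) : Prop :=
  ∃ bi : G.A i, ∀ a : (j : Fin N) → G.A j,
    G.u (Function.update a i ai) i < G.u (Function.update a i bi) i

/-! ## Solution concepts and axioms -/

abbrev SolCon (N : ℕ) := (G : Game N) → Set (Profile G)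

/-- A solution concept assigns to each game a nonempty set of mixed strategy profiles. -/
def IsSolutionConcept {N : ℕ} (S : SolCon N) : Prop :=
  ∀ G, (S G).Nonempty ∧ ∀ p ∈ S G, IsMixed G p

/-- The composite game `G ⊗ H`. -/
def Game.comp {N : ℕ} (G H : Game N) : Game N where
  A := fun i => G.A i × H.A i
  fintypeA := fun i => inferInstance
  nonemptyA := fun i => inferInstance
  u := fun c i => G.u (fun j => (c j).1) i + H.u (fun j => (c j).2) i

/-- The product profile `p × q`. -/
def prodProfile {N : ℕ} {G H : Game N} (p : Profile G) (q : Profile H) :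
    Profile (G.comp H) := fun i ab => p i ab.1 * q i ab.2

def Bracketing {N : ℕ} (S : SolCon N) : Prop :=
  ∀ (G H : Game N) (p : Profile G) (q : Profile H),
    p ∈ S G → q ∈ S H → prodProfile p q ∈ S (G.comp H)

/-- The permuted game `G_π`. -/
def Game.permute {N : ℕ} (G : Game N) (π : Equiv.Perm (Fin N)) : Game N where
  A := fun i => G.A (π i)
  fintypeA := fun i => G.fintypeA (π i)
  nonemptyA := fun i => G.nonemptyA (π i)
  u := fun b i =>
    G.u (fun j => cast (congrArg G.A (π.apply_symm_apply j)) (b (π.symm j))) (π i)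

def Anonymity {N : ℕ} (S : SolCon N) : Prop :=
  ∀ (π : Equiv.Perm (Fin N)) (G : Game N) (p : Profile G),
    p ∈ S G → (fun i => p (π i)) ∈ S (G.permute π)

def ExpectationMonotone {N : ℕ} (S : SolCon N) : Prop :=
  ∀ G, ∀ p ∈ S G, ∀ i, ∀ ai bi : G.A i,
    expPay G p i bi < expPay G p i ai → p i bi ≤ p i ai

def ExpectationNeutral {N : ℕ} (S : SolCon N) : Prop :=
  ∀ G, ∀ p ∈ S G, ∀ i, ∀ ai bi : G.A i,
    expPay G p i ai = expPay G p i bi → p i ai = p i bi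

def DistributionMonotone {N : ℕ} (S : SolCon N) : Prop :=
  ∀ G, ∀ p ∈ S G, ∀ i, ∀ ai bi : G.A i,
    FOSDgtF (payMass G p i ai) (payMass G p i bi) → p i bi ≤ p i ai

def Interiority {N : ℕ} (S : SolCon N) : Prop :=
  ∀ G, ∀ p ∈ S G, ∀ i, ∀ ai : G.A i, 0 < p i ai

/-- The game with payoffs rescaled by `α`. -/
def Game.scale {N : ℕ} (G : Game N) (α : ℝ) : Game N :=
  { G with u := fun a i => α * G.u a i }

def ScaleInvariant {N : ℕ} (S : SolCon N) : Prop :=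
  ∀ G : Game N, ∀ p ∈ S G,
    (∀ i, ∀ ai : G.A i, p i ai = ((Fintype.card (G.A i) : ℝ))⁻¹) →
    ∀ α ∈ Set.Ioo (0 : ℝ) 1, p ∈ S (G.scale α)

def StratInvariant {N : ℕ} (S : SolCon N) : Prop :=
  ∀ (G : Game N) (u' : ((i : Fin N) → G.A i) → Fin N → ℝ),
    (∀ i, ∃ w : ((j : Fin N) → G.A j) → ℝ,
      (∀ a, ∀ bi : G.A i, w (Function.update a i bi) = w a) ∧
      (∀ a, u' a i = G.u a i + w a)) →
    S G = S { G with u := u' }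

/-! ## Equilibrium notions -/

def IsNash {N : ℕ} (G : Game N) (p : Profile G) : Prop :=
  ∀ i, ∀ ai : G.A i, 0 < p i ai → ∀ bi : G.A i, expPay G p i bi ≤ expPay G p i ai

def IsLQRE {N : ℕ} (lam : ℝ) (G : Game N) (p : Profile G) : Prop :=
  ∀ i, ∀ ai : G.A i,
    p i ai = Real.exp (lam * expPay G p i ai) / ∑ bi, Real.exp (lam * expPay G p i bi)

def IsNashPhi {N : ℕ} (Φ : (ℝ → ℝ) → ℝ) (G : Game N) (p : Profile G) : Prop :=
  ∀ i, ∀ ai : G.A i, 0 < p i ai → ∀ bi : G.A i,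
    Φ (payMass G p i bi) ≤ Φ (payMass G p i ai)

def IsLQREPhi {N : ℕ} (Φ : (ℝ → ℝ) → ℝ) (lam : ℝ) (G : Game N) (p : Profile G) : Prop :=
  ∀ i, ∀ ai : G.A i,
    p i ai = Real.exp (lam * Φ (payMass G p i ai)) /
      ∑ bi, Real.exp (lam * Φ (payMass G p i bi))

def IsFOSDNash {N : ℕ} (G : Game N) (p : Profile G) : Prop :=
  ∀ i, ∀ ai : G.A i,
    (∃ bi : G.A i, FOSDgtF (payMass G p i bi) (payMass G p i ai)) → p i ai = 0

def IsFOSDQRE {N : ℕ} (G : Game N) (p : Profile G) : Prop :=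
  (∀ i, ∀ ai : G.A i, 0 < p i ai) ∧
  ∀ i, ∀ ai bi : G.A i,
    FOSDgeF (payMass G p i ai) (payMass G p i bi) → p i bi ≤ p i ai

def IsMinMaxMean {N : ℕ} (l1 l2 l3 : ℝ) (G : Game N) (p : Profile G) : Prop :=
  ∀ i, ∀ ai : G.A i,
    p i ai = Real.exp (l1 * minPay G i ai + l2 * expPay G p i ai + l3 * maxPay G i ai) /
      ∑ bi, Real.exp (l1 * minPay G i bi + l2 * expPay G p i bi + l3 * maxPay G i bi)

def CompatibleEU {N : ℕ} (S : SolCon N) : Prop :=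
  ∃ f : ℝ → ℝ, StrictMono f ∧ Continuous f ∧
    ∀ G, ∀ p ∈ S G, ∀ i, ∀ ai bi : G.A i,
      expPayOf G p i bi f < expPayOf G p i ai f → p i bi ≤ p i ai

/-! ## Lotteries as compactly supported probability measures on ℝ -/

/-- Convolution of measures: distribution of the sum of independent draws. -/
def mconv (μ ν : Measure ℝ) : Measure ℝ := (μ.prod ν).map (fun z : ℝ × ℝ => z.1 + z.2)

/-- `npow μ m` is the `m`-fold convolution `μ^m`. -/
def npow (μ : Measure ℝ) : ℕ → Measure ℝ
  | 0 => Measure.dirac 0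
  | n + 1 => mconv (npow μ n) μ

/-- The distribution of `β` times a draw from `μ`. -/
def mscale (β : ℝ) (μ : Measure ℝ) : Measure ℝ := μ.map (fun x => β * x)

/-- `μ` is compactly supported. -/
def CompSupp (μ : Measure ℝ) : Prop := ∃ a b : ℝ, μ (Set.Icc a b)ᶜ = 0

/-- The minimum of the support of `μ`. -/
def minSupp (μ : Measure ℝ) : ℝ := sSup {x : ℝ | μ (Set.Iio x) = 0}

/-- The maximum of the support of `μ`. -/
def maxSupp (μ : Measure ℝ) : ℝ := sInf {x : ℝ | μ (Set.Ioi x) = 0}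

/-- Weak first-order stochastic dominance of `μ` over `ν`. -/
def FOSDgeM (μ ν : Measure ℝ) : Prop := ∀ t, μ (Set.Iic t) ≤ ν (Set.Iic t)

/-- Strict first-order stochastic dominance of `μ` over `ν`. -/
def FOSDgtM (μ ν : Measure ℝ) : Prop := FOSDgeM μ ν ∧ μ ≠ ν

/-- Monotone additive statistic on compactly supported lotteries (as measures). -/
def MASm (Φ : Measure ℝ → ℝ) : Prop :=
  (∀ c : ℝ, Φ (Measure.dirac c) = c) ∧
  (∀ μ ν : Measure ℝ, IsProbabilityMeasure μ → IsProbabilityMeasure ν →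
    CompSupp μ → CompSupp ν → Φ (mconv μ ν) = Φ μ + Φ ν) ∧
  (∀ μ ν : Measure ℝ, IsProbabilityMeasure μ → IsProbabilityMeasure ν →
    CompSupp μ → CompSupp ν → FOSDgeM μ ν → Φ ν ≤ Φ μ)

/-! ## Two-player games, unbundled -/

/-- `p` is a probability distribution on the finite type `α`. -/
def IsDist {α : Type*} [Fintype α] (p : α → ℝ) : Prop :=
  (∀ a, 0 ≤ p a) ∧ ∑ a, p a = 1

/-- Payoff lottery of player 1 playing `a` against the mixed strategy `q`. -/
def mass1 {α β : Type*} [Fintype β] (u : α → β → ℝ) (q : β → ℝ) (a : α) : ℝ → ℝ :=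
  fun t => ∑ b, if u a b = t then q b else 0

/-- Payoff lottery of player 2 playing `b` against the mixed strategy `p`. -/
def mass2 {α β : Type*} [Fintype α] (u : α → β → ℝ) (p : α → ℝ) (b : β) : ℝ → ℝ :=
  fun t => ∑ a, if u a b = t then p a else 0

/-- The distribution of a random variable on the uniform space `{1,…,m}`. -/
def distOf {m : ℕ} (X : Fin m → ℝ) : ℝ → ℝ :=
  fun t => (∑ ω : Fin m, if X ω = t then (1 : ℝ) else 0) / m


theorem isMixed_delta_update {N : ℕ} {G : Game N} {p : Profile G} (hp : IsMixed G p)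
    (i : Fin N) (ai : G.A i) : IsMixed G (Function.update p i (delta ai)) := by
  intro j
  by_cases h : j = i
  · subst h
    simp only [Function.update_self]
    refine ⟨fun b => ?_, ?_⟩
    · unfold delta
      split_ifs <;> norm_num
    · classical
      simp [delta]
  · simpa only [Function.update_of_ne h] using hp j

theorem IsMixed.sum_weight {N : ℕ} {G : Game N} {p : Profile G} (hp : IsMixed G p) :
    ∑ a, weight G p a = 1 := by
  unfold weight
  rw [← Fintype.prod_sum]
  exact Finset.prod_eq_one fun j _ => (hp j).2

/-- Profiles of a composite game are pairs of profiles. -/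
def compProfileEquiv {N : ℕ} (G H : Game N) :
    ((j : Fin N) → (G.comp H).A j) ≃ ((j : Fin N) → G.A j) × ((j : Fin N) → H.A j) where
  toFun c := (fun j => (c j).1, fun j => (c j).2)
  invFun c := fun j => (c.1 j, c.2 j)
  left_inv _ := rfl
  right_inv _ := rfl

theorem delta_prod {α β : Type*} (a : α) (b : β) (c : α × β) :
    delta (a, b) c = delta a c.1 * delta b c.2 := by
  unfold delta
  by_cases h1 : c.1 = a <;> by_cases h2 : c.2 = b <;> simp [h1, h2, Prod.ext_iff]

theorem weight_comp {N : ℕ} {G H : Game N} (p : Profile G) (q : Profile H) (i : Fin N)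
    (a : G.A i) (x : H.A i) (c : (j : Fin N) → (G.comp H).A j) :
    weight (G.comp H) (Function.update (prodProfile p q) i (delta (a, x))) c =
      weight G (Function.update p i (delta a)) (fun j => (c j).1) *
        weight H (Function.update q i (delta x)) (fun j => (c j).2) := by
  unfold weight
  rw [← Finset.prod_mul_distrib]
  refine Finset.prod_congr rfl fun j _ => ?_
  by_cases h : j = i
  · subst h
    have hL : Function.update (prodProfile p q) j (delta (a, x)) j = delta (a, x) :=
      Function.update_self ..
    refine (congrFun hL (c j)).trans ?_
    rw [Function.update_self, Function.update_self]
    exact delta_prod a x (c j)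
  · have hL : Function.update (prodProfile p q) i (delta (a, x)) j = prodProfile p q j :=
      Function.update_of_ne h ..
    refine (congrFun hL (c j)).trans ?_
    rw [Function.update_of_ne h, Function.update_of_ne h]
    rfl

/-- Expected payoffs add up across the components of a composite game. -/
theorem expPay_comp {N : ℕ} {G H : Game N} {p : Profile G} {q : Profile H}
    (hp : IsMixed G p) (hq : IsMixed H q) (i : Fin N) (a : G.A i) (x : H.A i) :
    expPay (G.comp H) (prodProfile p q) i (a, x) = expPay G p i a + expPay H q i x := by
  have hp1 := (isMixed_delta_update hp i a).sum_weight
  have hq1 := (isMixed_delta_update hq i x).sum_weight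
  have key : expPay (G.comp H) (prodProfile p q) i (a, x) =
      ∑ c : ((j : Fin N) → G.A j) × ((j : Fin N) → H.A j),
        weight G (Function.update p i (delta a)) c.1 *
          weight H (Function.update q i (delta x)) c.2 * (G.u c.1 i + H.u c.2 i) := by
    refine Fintype.sum_equiv (compProfileEquiv G H) _ _ fun c => ?_
    exact congrArg (· * _) (weight_comp p q i a x c)
  rw [key, Fintype.sum_prod_type]
  calc
    _ = ∑ b, (weight G (Function.update p i (delta a)) b * G.u b i *
            (∑ d, weight H (Function.update q i (delta x)) d) +
          weight G (Function.update p i (delta a)) b * expPay H q i x) := by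
      refine Finset.sum_congr rfl fun b _ => ?_
      simp only [expPay, Finset.mul_sum, ← Finset.sum_add_distrib]
      exact Finset.sum_congr rfl fun d _ => by ring
    _ = _ := by
      rw [hq1, Finset.sum_add_distrib, ← Finset.sum_mul, ← Finset.sum_mul, hp1, mul_one, one_mul]
      rfl

/-- The game in which every player earns `ε` by choosing `true`, whatever the others do. -/
def bonusGame (N : ℕ) (ε : ℝ) : Game N where
  A := fun _ => Bool
  fintypeA := fun _ => inferInstance
  nonemptyA := fun _ => inferInstance
  u := fun a i => if a i = true then ε else 0

theorem expPay_bonusGame {N : ℕ} {ε : ℝ} {q : Profile (bonusGame N ε)}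
    (hq : IsMixed (bonusGame N ε) q) (i : Fin N) (x : Bool) :
    expPay (bonusGame N ε) q i x = if x = true then ε else 0 := by
  have hq1 := (isMixed_delta_update hq i x).sum_weight
  rw [← one_mul (if x = true then ε else 0), ← hq1, Finset.sum_mul]
  refine Finset.sum_congr rfl fun a _ => ?_
  by_cases h : a i = x
  · simp [bonusGame, h]
  · have h0 : weight (bonusGame N ε) (Function.update q i (delta x)) a = 0 :=
      Finset.prod_eq_zero (Finset.mem_univ i) (by simp [delta, h])
    rw [h0, zero_mul, zero_mul]

theorem strictlyDominated_bonusGame {N : ℕ} {ε : ℝ} (hε : 0 < ε) (i : Fin N) :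
    StrictlyDominated (bonusGame N ε) i false :=
  ⟨true, fun a => by
    have hu : ∀ x : Bool, (bonusGame N ε).u
        (Function.update (β := (bonusGame N ε).A) a i x) i = if x = true then ε else 0 :=
      fun x => congrArg (fun y : Bool => if y = true then ε else 0) (Function.update_self ..)
    have h := (hu false).trans_lt (lt_of_lt_of_eq ?_ (hu true).symm)
    · exact h
    · simpa using hε⟩

/-- bracketing + expectation-monotonicity + never playing strictly
dominated actions imply that `S` refines Nash. -/
theorem stmt1 {N : ℕ} (hN : 2 ≤ N) (S : SolCon N) (hS : IsSolutionConcept S)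
    (hBr : Bracketing S) (hEM : ExpectationMonotone S)
    (hDom : ∀ G, ∀ p ∈ S G, ∀ i, ∀ ai : G.A i, StrictlyDominated G i ai → p i ai = 0) :
    ∀ G, ∀ p ∈ S G, IsNash G p := by
  intro G p hp i a ha b
  by_contra! hlt
  set ε := (expPay G p i b - expPay G p i a) / 2 with hε
  have hε0 : 0 < ε := by rw [hε]; linarith
  obtain ⟨q, hq⟩ := (hS (bonusGame N ε)).1
  have hqm := (hS _).2 q hq
  have hpm := (hS _).2 p hp
  have hfalse : q i false = 0 := hDom _ q hq i false (strictlyDominated_bonusGame hε0 i)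
  have htrue : q i true = 1 := by
    have hsum : q i true + q i false = 1 := (Fintype.sum_bool (q i)).symm.trans (hqm i).2
    linarith
  have h1 := (expPay_comp hpm hqm i a true).trans
    (congrArg (expPay G p i a + ·) (expPay_bonusGame hqm i true))
  have h2 := (expPay_comp hpm hqm i b false).trans
    (congrArg (expPay G p i b + ·) (expPay_bonusGame hqm i false))
  simp only [if_true, Bool.false_eq_true, if_false] at h1 h2
  have hle := hEM _ _ (hBr G _ p q hp hq) i (b, false) (a, true)
    (lt_of_eq_of_lt h1 (lt_of_lt_of_eq (by linarith) h2.symm))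
  have hle' : p i a * q i true ≤ p i b * q i false := hle
  rw [hfalse, htrue] at hle'
  linarith

end Paper
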